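/- arXiv:2104.05288 — 8 statements merged into one kernel-verified Lean document; each statement's English description precedes it below -/
import Mathlib

section
/- Let an X3C instance with ground set of size q (3 | q) be given and let G be the associated network with homologous edge sets R_0, R_1, …, R_q and constant deviation function Δ(x) = x + 1. Then the X3C instance has a solution if and only if there exists an integer almost-equal flow in G of value 7q/3. -/
/-- An instance of Exact-3-Cover: a ground set `Fin q` and a family of `q`
three-element subsets. -/
structure X3C (q : ℕ) where
  sets : Fin q → Finset (Fin q)
  card3 : ∀ i, (sets i).card = 3

/-- A solution of X3C: `q/3` pairwise disjoint sets of the family covering the ground set. -/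
def X3C.HasSolution {q : ℕ} (I : X3C q) : Prop :=
  ∃ T : Finset (Fin q),
    T.card = q / 3 ∧
    (∀ i ∈ T, ∀ i' ∈ T, i ≠ i' → Disjoint (I.sets i) (I.sets i')) ∧
    T.biUnion I.sets = Finset.univ

/-- An integer almost-equal flow (constant deviation `Δ(x) = x + 1`) in the network `G`
associated to an X3C instance: `fs i` is the flow on the edge `(s, S_i)` (capacity 5),
`fb i` the flow on the bonus edge `(S_i, t)` (capacity 2), `fm i j` the flow on the
edge `(S_i, a_j)` (present with capacity 1 iff `a_j ∈ S_i`), and `fa j` the flow on the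
edge `(a_j, t)` (capacity 1).  The homologous edge sets are
`R_i = {(S_i,a_j) : a_j ∈ S_i} ∪ {(S_i,t)}` and `R_0 = {(a_j,t) : j}`; requiring
`f e ≤ (min_{e' ∈ R} f e') + 1` for all `e ∈ R` is expressed equivalently as
`f e ≤ f e' + 1` for all `e, e' ∈ R`. -/
structure IntAEFlow {q : ℕ} (I : X3C q) where
  fs : Fin q → ℤ
  fb : Fin q → ℤ
  fm : Fin q → Fin q → ℤ
  fa : Fin q → ℤ
  fs_nonneg : ∀ i, 0 ≤ fs i
  fs_le : ∀ i, fs i ≤ 5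
  fb_nonneg : ∀ i, 0 ≤ fb i
  fb_le : ∀ i, fb i ≤ 2
  fm_nonneg : ∀ i j, 0 ≤ fm i j
  fm_le : ∀ i j, fm i j ≤ 1
  fm_not_mem : ∀ i j, j ∉ I.sets i → fm i j = 0
  fa_nonneg : ∀ j, 0 ≤ fa j
  fa_le : ∀ j, fa j ≤ 1
  consS : ∀ i, fs i = (∑ j ∈ I.sets i, fm i j) + fb i
  consA : ∀ j, (∑ i, fm i j) = fa j
  hom_mm : ∀ i, ∀ j ∈ I.sets i, ∀ j' ∈ I.sets i, fm i j ≤ fm i j' + 1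
  hom_mb : ∀ i, ∀ j ∈ I.sets i, fm i j ≤ fb i + 1
  hom_bm : ∀ i, ∀ j ∈ I.sets i, fb i ≤ fm i j + 1
  hom_a : ∀ j j', fa j ≤ fa j' + 1

/-- The value of the flow: the net flow into the sink `t`. -/
def IntAEFlow.val {q : ℕ} {I : X3C q} (f : IntAEFlow I) : ℤ :=
  (∑ i, f.fb i) + (∑ j, f.fa j)

open Finset in
theorem IntAEFlow.sum_fm_eq_sum_sets {q : ℕ} {I : X3C q} (f : IntAEFlow I) (i : Fin q) :
    ∑ j, f.fm i j = ∑ j ∈ I.sets i, f.fm i j :=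
  (sum_subset (subset_univ _) fun j _ hj => f.fm_not_mem i j hj).symm

open Finset in
theorem IntAEFlow.sum_sets_fm_eq_sum_fa {q : ℕ} {I : X3C q} (f : IntAEFlow I) :
    ∑ i, ∑ j ∈ I.sets i, f.fm i j = ∑ j, f.fa j := by
  simp_rw [← f.sum_fm_eq_sum_sets, ← f.consA]
  exact sum_comm

open Finset in
theorem IntAEFlow.three_mul_fb_le {q : ℕ} {I : X3C q} (f : IntAEFlow I) (i : Fin q) :
    3 * f.fb i ≤ 3 + ∑ j ∈ I.sets i, f.fm i j := by
  have h : ∑ _j ∈ I.sets i, f.fb i ≤ ∑ j ∈ I.sets i, (f.fm i j + 1) :=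
    sum_le_sum fun j hj => f.hom_bm i j hj
  simp only [sum_const, sum_add_distrib, I.card3, nsmul_eq_mul] at h
  push_cast at h
  linarith

open Finset in
/-- A flow of value at least `7q/3` saturates every edge `(a_j, t)`, and every bonus edge
exceeds the average flow on the edges from `S_i` into the ground set by exactly one. -/
theorem IntAEFlow.tight_of_le_val {q : ℕ} {I : X3C q} (f : IntAEFlow I)
    (hv : 7 * (q : ℤ) ≤ 3 * f.val) :
    (∀ j, f.fa j = 1) ∧ ∀ i, 3 * f.fb i = 3 + ∑ j ∈ I.sets i, f.fm i j := by
  have hb : ∑ i, 3 * f.fb i ≤ ∑ i, (3 + ∑ j ∈ I.sets i, f.fm i j) :=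
    sum_le_sum fun i _ => f.three_mul_fb_le i
  have ha : ∑ j, f.fa j ≤ ∑ _j : Fin q, (1 : ℤ) := sum_le_sum fun j _ => f.fa_le j
  have hb' : ∑ i, (3 + ∑ j ∈ I.sets i, f.fm i j) = 3 * (q : ℤ) + ∑ j, f.fa j := by
    rw [sum_add_distrib, f.sum_sets_fm_eq_sum_fa]
    simp [mul_comm]
  have ha' : ∑ _j : Fin q, (1 : ℤ) = q := by simp
  have hm : ∑ i, 3 * f.fb i = 3 * ∑ i, f.fb i := (mul_sum _ _ _).symm
  unfold IntAEFlow.val at hv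
  constructor
  · have h := (sum_eq_sum_iff_of_le fun j _ => f.fa_le j).1 (by linarith :
      ∑ j, f.fa j = ∑ _j : Fin q, (1 : ℤ))
    exact fun j => h j (mem_univ j)
  · have h := (sum_eq_sum_iff_of_le fun i _ => f.three_mul_fb_le i).1 (by linarith :
      ∑ i, 3 * f.fb i = ∑ i, (3 + ∑ j ∈ I.sets i, f.fm i j))
    exact fun i => h i (mem_univ i)

theorem X3C.card_mul_three_of_cover {q : ℕ} (I : X3C q) {T : Finset (Fin q)}
    (hd : ∀ i ∈ T, ∀ i' ∈ T, i ≠ i' → Disjoint (I.sets i) (I.sets i'))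
    (hc : T.biUnion I.sets = Finset.univ) : T.card * 3 = q := by
  have h := Finset.card_biUnion hd
  rw [hc] at h
  simpa [I.card3] using h.symm

open Finset in
theorem IntAEFlow.hasSolution_of_le_val {q : ℕ} {I : X3C q} (f : IntAEFlow I)
    (hv : 7 * (q : ℤ) ≤ 3 * f.val) : I.HasSolution := by
  obtain ⟨ha, hb⟩ := f.tight_of_le_val hv
  have hone : ∀ i, f.fb i = 2 → ∀ j ∈ I.sets i, f.fm i j = 1 := fun i hi j hj => by
    have := f.hom_bm i j hj
    have := f.fm_le i j
    omega
  have hd : ∀ i ∈ univ.filter (f.fb · = 2), ∀ i' ∈ univ.filter (f.fb · = 2), i ≠ i' →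
      Disjoint (I.sets i) (I.sets i') := by
    intro i hi i' hi' hne
    rw [disjoint_left]
    intro j hj hj'
    have h := add_le_sum (f := fun k => f.fm k j) (fun k _ => f.fm_nonneg k j)
      (mem_univ i) (mem_univ i') hne
    simp only [f.consA, ha, hone i (mem_filter.1 hi).2 j hj,
      hone i' (mem_filter.1 hi').2 j hj'] at h
    omega
  have hc : (univ.filter (f.fb · = 2)).biUnion I.sets = univ := by
    refine eq_univ_of_forall fun j => ?_
    have hj : ∑ i, f.fm i j ≠ 0 := by rw [f.consA, ha]; exact one_ne_zero
    obtain ⟨i, -, hi⟩ := exists_ne_zero_of_sum_ne_zero hj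
    have hmem : j ∈ I.sets i := by
      by_contra h
      exact hi (f.fm_not_mem i j h)
    refine mem_biUnion.2 ⟨i, mem_filter.2 ⟨mem_univ i, ?_⟩, hmem⟩
    have hle := single_le_sum (f := f.fm i) (fun k _ => f.fm_nonneg i k) hmem
    have := f.fm_nonneg i j
    have := f.fb_le i
    have := hb i
    omega
  have := I.card_mul_three_of_cover hd hc
  exact ⟨_, by omega, hd, hc⟩

open Finset in
/-- The flow associated to an exact cover `T`: it saturates all edges leaving the chosen sets,
and sends one unit along the bonus edge of every other set. -/
def X3C.flowOfCover {q : ℕ} (I : X3C q) (T : Finset (Fin q))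
    (hd : ∀ i ∈ T, ∀ i' ∈ T, i ≠ i' → Disjoint (I.sets i) (I.sets i'))
    (hc : T.biUnion I.sets = univ) : IntAEFlow I where
  fs i := if i ∈ T then 5 else 1
  fb i := if i ∈ T then 2 else 1
  fm i j := if i ∈ T ∧ j ∈ I.sets i then 1 else 0
  fa _ := 1
  fs_nonneg i := by split_ifs <;> norm_num
  fs_le i := by split_ifs <;> norm_num
  fb_nonneg i := by split_ifs <;> norm_num
  fb_le i := by split_ifs <;> norm_num
  fm_nonneg i j := by split_ifs <;> norm_num
  fm_le i j := by split_ifs <;> norm_num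
  fm_not_mem i j h := by simp [h]
  fa_nonneg _ := by norm_num
  fa_le _ := le_rfl
  consS i := by
    by_cases h : i ∈ T <;> simp [h, I.card3]
  consA j := by
    obtain ⟨i, hi, hj⟩ := mem_biUnion.1 (hc ▸ mem_univ j)
    rw [sum_eq_single i, if_pos ⟨hi, hj⟩]
    · intro i' _ hne
      exact if_neg fun h => disjoint_left.1 (hd i' h.1 i hi hne) h.2 hj
    · exact fun h => absurd (mem_univ i) h
  hom_mm i j hj j' hj' := by split_ifs <;> norm_num
  hom_mb i j hj := by split_ifs <;> norm_num
  hom_bm i j hj := by by_cases h : i ∈ T <;> simp [h, hj]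
  hom_a _ _ := by norm_num

theorem X3C.val_flowOfCover {q : ℕ} (I : X3C q) (T : Finset (Fin q))
    (hd : ∀ i ∈ T, ∀ i' ∈ T, i ≠ i' → Disjoint (I.sets i) (I.sets i'))
    (hc : T.biUnion I.sets = Finset.univ) :
    (I.flowOfCover T hd hc).val = 2 * (q : ℤ) + T.card := by
  have h : ∀ i, (if i ∈ T then (2 : ℤ) else 1) = 1 + if i ∈ T then 1 else 0 := fun i => by
    split_ifs <;> norm_num
  simp only [IntAEFlow.val, flowOfCover, h, Finset.sum_add_distrib]
  simp
  ring

/-- The X3C instance has a solution iff the associated network admits an integer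
almost-equal flow of value `7q/3`. -/
theorem x3c_has_solution_iff_int_ae_flow_of_value
    (q : ℕ) (hq : 3 ∣ q) (I : X3C q) :
    I.HasSolution ↔ ∃ f : IntAEFlow I, f.val = 7 * (q : ℤ) / 3 := by
  constructor
  · rintro ⟨T, hT, hd, hc⟩
    refine ⟨I.flowOfCover T hd hc, ?_⟩
    rw [I.val_flowOfCover]
    omega
  · rintro ⟨f, hf⟩
    exact f.hasSolution_of_le_val (by omega)
end

section
/- Let S' be a solution of the X3C instance and define f on the edges of the associated network G by: f(s,S_i) = 5 if S_i ∈ S' and 1 otherwise; f(S_i,a_j) = 1 if S_i ∈ S' and a_j ∈ S_i, and 0 otherwise; f(S_i,t) = 2 if S_i ∈ S' and 1 otherwise; f(a_j,t) = 1 for all j. Then f is a feasible integer almost-equal flow in G (it satisfies the capacity constraints, flow conservation at every node other than s and t, and the homologous edge set conditions for Δ(x)=x+1) and val(f) = 7q/3. -/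
/-- Given a solution `T` of the X3C instance, the explicitly defined flow
(`f(s,S_i) = 5` if `S_i ∈ T` else `1`; `f(S_i,a_j) = 1` if `S_i ∈ T` and `a_j ∈ S_i`
else `0`; `f(S_i,t) = 2` if `S_i ∈ T` else `1`; `f(a_j,t) = 1`) is a feasible integer
almost-equal flow of value `7q/3`. -/
theorem flow_from_x3c_solution
    (q : ℕ) (hq : 3 ∣ q) (I : X3C q)
    (T : Finset (Fin q)) (hcard : T.card = q / 3)
    (hdisj : ∀ i ∈ T, ∀ i' ∈ T, i ≠ i' → Disjoint (I.sets i) (I.sets i'))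
    (hcover : T.biUnion I.sets = Finset.univ) :
    ∃ f : IntAEFlow I,
      (∀ i, f.fs i = if i ∈ T then 5 else 1) ∧
      (∀ i j, f.fm i j = if i ∈ T ∧ j ∈ I.sets i then 1 else 0) ∧
      (∀ i, f.fb i = if i ∈ T then 2 else 1) ∧
      (∀ j, f.fa j = 1) ∧
      f.val = 7 * (q : ℤ) / 3 := by
  have hcons : ∀ j, (∑ i, if i ∈ T ∧ j ∈ I.sets i then (1 : ℤ) else 0) = 1 := by
    intro j
    obtain ⟨i₀, hi₀, hj₀⟩ := Finset.mem_biUnion.mp (hcover ▸ Finset.mem_univ j)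
    rw [Finset.sum_eq_single_of_mem i₀ (Finset.mem_univ _), if_pos ⟨hi₀, hj₀⟩]
    rintro i - hne
    refine if_neg fun ⟨hi, hj⟩ => ?_
    exact Finset.disjoint_left.mp (hdisj i hi i₀ hi₀ hne) hj hj₀
  refine ⟨{
    fs := fun i => if i ∈ T then 5 else 1
    fb := fun i => if i ∈ T then 2 else 1
    fm := fun i j => if i ∈ T ∧ j ∈ I.sets i then 1 else 0
    fa := fun _ => 1
    fs_nonneg := fun i => by split_ifs <;> norm_num
    fs_le := fun i => by split_ifs <;> norm_num
    fb_nonneg := fun i => by split_ifs <;> norm_num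
    fb_le := fun i => by split_ifs <;> norm_num
    fm_nonneg := fun i j => by split_ifs <;> norm_num
    fm_le := fun i j => by split_ifs <;> norm_num
    fm_not_mem := fun i j hj => if_neg fun h => hj h.2
    fa_nonneg := fun _ => zero_le_one
    fa_le := fun _ => le_rfl
    consS := fun i => by
      by_cases hi : i ∈ T
      · have hsum : (∑ j ∈ I.sets i, if i ∈ T ∧ j ∈ I.sets i then (1 : ℤ) else 0) = 3 := by
          rw [Finset.sum_congr rfl fun j hj => if_pos ⟨hi, hj⟩]
          simp [I.card3]
        rw [hsum, if_pos hi, if_pos hi]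
        norm_num
      · simp [hi]
    consA := hcons
    hom_mm := fun i j _ j' _ => by split_ifs <;> norm_num
    hom_mb := fun i j _ => by split_ifs <;> norm_num
    hom_bm := fun i j hj => by by_cases hi : i ∈ T <;> simp [hi, hj]
    hom_a := fun _ _ => by norm_num },
    fun _ => rfl, fun _ _ => rfl, fun _ => rfl, fun _ => rfl, ?_⟩
  have hbonus : (∑ i, if i ∈ T then (2 : ℤ) else 1) = q + T.card := by
    have hsplit : ∀ i, (if i ∈ T then (2 : ℤ) else 1) = 1 + if i ∈ T then 1 else 0 := by
      intro i
      split_ifs <;> norm_num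
    simp [hsplit, Finset.sum_add_distrib]
  simp only [IntAEFlow.val, hbonus, Finset.sum_const, Finset.card_univ, Fintype.card_fin,
    nsmul_eq_mul, mul_one]
  omega
end

section
/- In the network G constructed from an X3C instance, if a feasible integer almost-equal flow f (with constant deviation Δ(x)=x+1) satisfies f(a_j,t) = 0 for at least one index j, then val(f) ≤ 7q/3 − 2. -/
/-- Bonus flow above `1` on `(S_i, t)` forces unit flow on all three edges leaving `S_i`. -/
theorem IntAEFlow.three_mul_fb_sub_one_le {q : ℕ} {I : X3C q} (f : IntAEFlow I) (i : Fin q) :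
    3 * (f.fb i - 1) ≤ ∑ j, f.fm i j := by
  have hsum : ∑ j ∈ I.sets i, f.fm i j = ∑ j, f.fm i j :=
    Finset.sum_subset (Finset.subset_univ _) fun j _ hj => f.fm_not_mem i j hj
  have h := Finset.card_nsmul_le_sum (I.sets i) (f.fm i) (f.fb i - 1)
    fun j hj => by linarith [f.hom_bm i j hj]
  rw [I.card3 i, hsum] at h
  simpa using h

theorem IntAEFlow.sum_fb_le {q : ℕ} {I : X3C q} (f : IntAEFlow I) :
    3 * (∑ i, f.fb i) ≤ 3 * q + ∑ j, f.fa j := by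
  have h := Finset.sum_le_sum fun i (_ : i ∈ Finset.univ) => f.three_mul_fb_sub_one_le i
  rw [Finset.sum_comm, Finset.sum_congr rfl fun j _ => f.consA j, ← Finset.mul_sum,
    Finset.sum_sub_distrib] at h
  simp only [Finset.sum_const, Finset.card_univ, Fintype.card_fin, nsmul_eq_mul, mul_one] at h
  linarith

theorem IntAEFlow.sum_fa_lt {q : ℕ} {I : X3C q} (f : IntAEFlow I) {j : Fin q}
    (hj : f.fa j = 0) : ∑ j, f.fa j < q := by
  have h : ∑ j, f.fa j < ∑ _j : Fin q, (1 : ℤ) :=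
    Finset.sum_lt_sum (fun k _ => f.fa_le k) ⟨j, Finset.mem_univ j, by simp [hj]⟩
  simpa using h

/-- If a feasible integer almost-equal flow sends no flow on some edge `(a_j, t)`,
then its value is at most `7q/3 - 2`. -/
theorem int_ae_flow_value_le_of_zero_edge
    (q : ℕ) (hq : 3 ∣ q) (I : X3C q) (f : IntAEFlow I)
    (j : Fin q) (hj : f.fa j = 0) :
    f.val ≤ 7 * (q : ℤ) / 3 - 2 := by
  have hb := f.sum_fb_le
  have ha := f.sum_fa_lt hj
  obtain ⟨k, rfl⟩ := hq
  unfold IntAEFlow.val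
  push_cast at *
  omega
end

section
/- If the X3C instance has a solution, then the extended network G' (with k ≥ 1 bonus edges (s,t'') of capacity 2 and deviation Δ(x)=x+1 on the homologous set R_b) admits a feasible integer almost-equal s-t''-flow of value 7q/3 + 2k (all 7q/3 parallel edges (t',t'') carry one unit and each bonus edge (s,t'') carries two units). -/
/-- An integer almost-equal `s`-`t''`-flow in the extended network `G'` obtained from
the network `G` of an X3C instance by adding nodes `t'`, `t''`, one edge `(t,t')` of
capacity `7q/3`, `7q/3` parallel edges `(t',t'')` of capacity 1, and `k` parallel
bonus edges `(s,t'')` of capacity 2.  Fields: `fs i` is the flow on `(s,S_i)` (cap. 5),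
`fb i` on the edge `(S_i,t)` (cap. 2), `fm i j` on `(S_i,a_j)` (cap. 1, present iff
`a_j ∈ S_i`), `fa j` on `(a_j,t)` (cap. 1), `ft` on `(t,t')`, `fp p` on the `p`-th
parallel edge `(t',t'')`, and `fc b` on the `b`-th bonus edge `(s,t'')`.
The homologous sets `R_1,…,R_q,R_0` and the additional set `R_b` (all edges `(t',t'')`
together with all bonus edges `(s,t'')`) carry the deviation `Δ(x) = x + 1`, expressed
equivalently as `f e ≤ f e' + 1` for all `e, e'` in the same homologous set. -/
structure ExtIntAEFlow {q : ℕ} (I : X3C q) (k : ℕ) where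
  fs : Fin q → ℤ
  fb : Fin q → ℤ
  fm : Fin q → Fin q → ℤ
  fa : Fin q → ℤ
  ft : ℤ
  fp : Fin (7 * q / 3) → ℤ
  fc : Fin k → ℤ
  fs_nonneg : ∀ i, 0 ≤ fs i
  fs_le : ∀ i, fs i ≤ 5
  fb_nonneg : ∀ i, 0 ≤ fb i
  fb_le : ∀ i, fb i ≤ 2
  fm_nonneg : ∀ i j, 0 ≤ fm i j
  fm_le : ∀ i j, fm i j ≤ 1
  fm_not_mem : ∀ i j, j ∉ I.sets i → fm i j = 0
  fa_nonneg : ∀ j, 0 ≤ fa j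
  fa_le : ∀ j, fa j ≤ 1
  ft_nonneg : 0 ≤ ft
  ft_le : ft ≤ 7 * (q : ℤ) / 3
  fp_nonneg : ∀ p, 0 ≤ fp p
  fp_le : ∀ p, fp p ≤ 1
  fc_nonneg : ∀ b, 0 ≤ fc b
  fc_le : ∀ b, fc b ≤ 2
  consS : ∀ i, fs i = (∑ j ∈ I.sets i, fm i j) + fb i
  consA : ∀ j, (∑ i, fm i j) = fa j
  consT : (∑ i, fb i) + (∑ j, fa j) = ft
  consT' : ft = ∑ p, fp p
  hom_mm : ∀ i, ∀ j ∈ I.sets i, ∀ j' ∈ I.sets i, fm i j ≤ fm i j' + 1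
  hom_mb : ∀ i, ∀ j ∈ I.sets i, fm i j ≤ fb i + 1
  hom_bm : ∀ i, ∀ j ∈ I.sets i, fb i ≤ fm i j + 1
  hom_a : ∀ j j', fa j ≤ fa j' + 1
  hom_pp : ∀ p p', fp p ≤ fp p' + 1
  hom_pc : ∀ p b, fp p ≤ fc b + 1
  hom_cp : ∀ b p, fc b ≤ fp p + 1
  hom_cc : ∀ b b', fc b ≤ fc b' + 1

/-- The value of the flow: the net flow into the sink `t''`. -/
def ExtIntAEFlow.val {q : ℕ} {I : X3C q} {k : ℕ} (f : ExtIntAEFlow I k) : ℤ :=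
  (∑ p, f.fp p) + (∑ b, f.fc b)

/-- Each element is covered by exactly one set of a solution. -/
theorem X3C.sum_cover_eq_one {q : ℕ} (I : X3C q) {T : Finset (Fin q)}
    (hdisj : ∀ i ∈ T, ∀ i' ∈ T, i ≠ i' → Disjoint (I.sets i) (I.sets i'))
    (hcover : T.biUnion I.sets = Finset.univ) (j : Fin q) :
    ∑ i, (if i ∈ T ∧ j ∈ I.sets i then (1 : ℤ) else 0) = 1 := by
  obtain ⟨i₀, hi₀, hj⟩ := Finset.mem_biUnion.mp (hcover ▸ Finset.mem_univ j)
  rw [Finset.sum_eq_single i₀, if_pos ⟨hi₀, hj⟩]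
  · rintro i - hne
    refine if_neg fun h => ?_
    exact Finset.disjoint_left.mp (hdisj i h.1 i₀ hi₀ hne) h.2 hj
  · simp

/-- If the X3C instance has a solution, then the extended network admits a feasible
integer almost-equal `s`-`t''`-flow of value `7q/3 + 2k`, in which all `7q/3` parallel
edges `(t',t'')` carry one unit and each bonus edge `(s,t'')` carries two units. -/
theorem ext_flow_of_x3c_solution
    (q : ℕ) (hq : 3 ∣ q) (I : X3C q) (k : ℕ) (hk : 1 ≤ k)
    (hsol : I.HasSolution) :
    ∃ f : ExtIntAEFlow I k,
      (∀ p, f.fp p = 1) ∧ (∀ b, f.fc b = 2) ∧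
      f.val = 7 * (q : ℤ) / 3 + 2 * k := by
  obtain ⟨T, hcard, hdisj, hcover⟩ := hsol
  obtain ⟨m, rfl⟩ := hq
  have hT : T.card = m := by omega
  have hdiv : 7 * (3 * m) / 3 = 7 * m := by omega
  have hdivZ : 7 * ((3 * m : ℕ) : ℤ) / 3 = 7 * m := by omega
  have hbypass : ∑ i, (if i ∈ T then (2 : ℤ) else 1) = 4 * m := by
    have h : ∀ i, (if i ∈ T then (2 : ℤ) else 1) = 1 + if i ∈ T then 1 else 0 := by
      intro i; split_ifs <;> rfl
    simp only [h, Finset.sum_add_distrib]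
    simp [hT]
    ring
  refine ⟨{
    fs := fun i => if i ∈ T then 5 else 1
    fb := fun i => if i ∈ T then 2 else 1
    fm := fun i j => if i ∈ T ∧ j ∈ I.sets i then 1 else 0
    fa := fun _ => 1
    ft := 7 * m
    fp := fun _ => 1
    fc := fun _ => 2
    fs_nonneg := by intro i; split_ifs <;> norm_num
    fs_le := by intro i; split_ifs <;> norm_num
    fb_nonneg := by intro i; split_ifs <;> norm_num
    fb_le := by intro i; split_ifs <;> norm_num
    fm_nonneg := by intro i j; split_ifs <;> norm_num
    fm_le := by intro i j; split_ifs <;> norm_num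
    fm_not_mem := fun i j hj => if_neg fun h => hj h.2
    fa_nonneg := by simp
    fa_le := by simp
    ft_nonneg := by positivity
    ft_le := hdivZ.ge
    fp_nonneg := by simp
    fp_le := by simp
    fc_nonneg := by simp
    fc_le := by simp
    consS := by
      intro i
      by_cases hi : i ∈ T
      · simp [hi, I.card3]
      · simp [hi]
    consA := I.sum_cover_eq_one hdisj hcover
    consT := by
      rw [hbypass]
      simp
      ring
    consT' := by simp [hdiv]
    hom_mm := by intro i j _ j' _; split_ifs <;> norm_num
    hom_mb := by intro i j _; split_ifs <;> norm_num
    hom_bm := by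
      intro i j hj
      by_cases hi : i ∈ T <;> simp [hi, hj]
    hom_a := by simp
    hom_pp := by simp
    hom_pc := by simp
    hom_cp := by simp
    hom_cc := by simp }, fun _ => rfl, fun _ => rfl, ?_⟩
  refine Eq.trans ?_ (congrArg (· + 2 * (k : ℤ)) hdivZ.symm)
  simp only [ExtIntAEFlow.val, Finset.sum_const, Finset.card_univ, Fintype.card_fin, hdiv, nsmul_eq_mul]
  push_cast
  ring
end

section
/- If the X3C instance has no solution, then every feasible integer almost-equal s-t''-flow f in the extended network G' (with k ≥ 1 bonus edges of capacity 2 and deviation Δ(x)=x+1 on all homologous sets) satisfies val(f) ≤ 7q/3 − 1 + k; consequently the ratio of the optimal values in the yes-case and the no-case tends to 2 as k → ∞. -/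
/-- The middle edges of a set whose edge to `t` carries two units are all saturated. -/
theorem ExtIntAEFlow.fm_eq_one_of_fb_eq_two {q k : ℕ} {I : X3C q} (f : ExtIntAEFlow I k)
    {i j : Fin q} (hi : f.fb i = 2) (hj : j ∈ I.sets i) : f.fm i j = 1 := by
  have h₁ := f.hom_bm i j hj
  have h₂ := f.fm_le i j
  omega

/-- Sets whose edges to `t` carry two units are pairwise disjoint. -/
theorem ExtIntAEFlow.disjoint_of_fb_eq_two {q k : ℕ} {I : X3C q} (f : ExtIntAEFlow I k)
    {i i' : Fin q} (hi : f.fb i = 2) (hi' : f.fb i' = 2) (hne : i ≠ i') :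
    Disjoint (I.sets i) (I.sets i') := by
  rw [Finset.disjoint_left]
  intro j hj hj'
  have h₁ := f.fm_eq_one_of_fb_eq_two hi hj
  have h₂ := f.fm_eq_one_of_fb_eq_two hi' hj'
  have h₃ : ∑ l ∈ {i, i'}, f.fm l j ≤ ∑ l, f.fm l j :=
    Finset.sum_le_sum_of_subset_of_nonneg (Finset.subset_univ _)
      fun l _ _ => f.fm_nonneg l j
  rw [Finset.sum_pair hne, f.consA] at h₃
  have h₄ := f.fa_le j
  omega

/-- A flow saturating `(t,t')` yields a solution of the X3C instance. -/
theorem ExtIntAEFlow.hasSolution_of_le_ft {q k : ℕ} (hq : 3 ∣ q) {I : X3C q}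
    (f : ExtIntAEFlow I k) (hf : 7 * (q : ℤ) / 3 ≤ f.ft) : I.HasSolution := by
  classical
  let T : Finset (Fin q) := Finset.univ.filter fun i => f.fb i = 2
  have hT : ∀ i ∈ T, f.fb i = 2 := fun i hi => (Finset.mem_filter.mp hi).2
  have hdisj : ∀ i ∈ T, ∀ i' ∈ T, i ≠ i' → Disjoint (I.sets i) (I.sets i') :=
    fun i hi i' hi' => f.disjoint_of_fb_eq_two (hT i hi) (hT i' hi')
  have hunion : (T.biUnion I.sets).card = T.card * 3 := by
    rw [Finset.card_biUnion hdisj, Finset.sum_const_nat fun i _ => I.card3 i]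
  have hle : (T.biUnion I.sets).card ≤ q := by
    simpa using Finset.card_le_univ (T.biUnion I.sets)
  have hb : ∑ i, f.fb i ≤ q + T.card := by
    calc ∑ i, f.fb i ≤ ∑ i, (1 + if f.fb i = 2 then 1 else 0) := by
          refine Finset.sum_le_sum fun i _ => ?_
          have := f.fb_le i
          split_ifs <;> omega
      _ = q + T.card := by simp [Finset.sum_add_distrib, T]
  have ha : ∑ j, f.fa j ≤ q := by
    simpa using Finset.sum_le_card_nsmul Finset.univ f.fa 1 fun j _ => f.fa_le j
  have ht := f.consT
  refine ⟨T, by omega, hdisj, Finset.eq_univ_of_card _ ?_⟩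
  rw [Fintype.card_fin]
  omega

/-- If some unit of capacity of the parallel edges `(t',t'')` is unused, then every bonus edge
carries at most one unit. -/
theorem ExtIntAEFlow.fc_le_one_of_ft_lt {q k : ℕ} {I : X3C q} (f : ExtIntAEFlow I k)
    (hf : f.ft < 7 * (q : ℤ) / 3) (b : Fin k) : f.fc b ≤ 1 := by
  obtain ⟨p, -, hp⟩ : ∃ p ∈ Finset.univ, f.fp p < 1 := by
    apply Finset.exists_lt_of_sum_lt
    rw [← f.consT']
    simpa using hf
  have := f.hom_cp b p
  omega

/-- The quotient `(a + 2k) / (a - 1 + k)` tends to `2`. -/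
theorem tendsto_add_two_mul_div_sub_one_add (a : ℝ) :
    Filter.Tendsto (fun k : ℕ => (a + 2 * k) / (a - 1 + k)) Filter.atTop (nhds 2) := by
  have hden : Filter.Tendsto (fun k : ℕ => a - 1 + (k : ℝ)) Filter.atTop Filter.atTop :=
    Filter.tendsto_atTop_add_const_left _ _ tendsto_natCast_atTop_atTop
  have hlim := (hden.const_div_atTop (2 - a)).const_add 2
  rw [add_zero] at hlim
  refine hlim.congr' ?_
  filter_upwards [hden.eventually_gt_atTop 0] with k hk
  field_simp
  ring

/-- If the X3C instance has no solution, then every feasible integer almost-equal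
`s`-`t''`-flow in the extended network (with `k ≥ 1` bonus edges of capacity 2) has
value at most `7q/3 - 1 + k`; consequently the ratio of the optimal values in the
yes-case (`7q/3 + 2k`) and the no-case (`7q/3 - 1 + k`) tends to `2` as `k → ∞`. -/
theorem ext_flow_value_le_of_no_x3c_solution
    (q : ℕ) (hq : 3 ∣ q) (I : X3C q) (hno : ¬ I.HasSolution) :
    (∀ k : ℕ, 1 ≤ k → ∀ f : ExtIntAEFlow I k, f.val ≤ 7 * (q : ℤ) / 3 - 1 + k) ∧
    Filter.Tendsto
      (fun k : ℕ => (7 * (q : ℝ) / 3 + 2 * k) / (7 * (q : ℝ) / 3 - 1 + k))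
      Filter.atTop (nhds 2) := by
  refine ⟨fun k _ f => ?_, tendsto_add_two_mul_div_sub_one_add _⟩
  have hft : f.ft < 7 * (q : ℤ) / 3 := by
    by_contra! h
    exact hno (f.hasSolution_of_le_ft hq h)
  have hc : ∑ b, f.fc b ≤ k := by
    simpa using Finset.sum_le_card_nsmul Finset.univ f.fc 1 fun b _ => f.fc_le_one_of_ft_lt hft b
  rw [ExtIntAEFlow.val, ← f.consT']
  omega
end

section
/- Let G = (V,E) be a finite directed graph with source s, sink t, capacities u : E → ℝ_{≥0}, a homologous edge set R ⊆ E, and a constant c ≥ 0; set u_R = min_{r∈R} u(r). For every function f : E → ℝ with 0 ≤ f(e) ≤ u(e) for all e ∈ E and flow conservation at every node other than s and t, the following are equivalent: (1) f(r) ≤ (min_{r'∈R} f(r')) + c for all r ∈ R; (2) there exists λ ∈ [0, u_R] with λ ≤ f(r) ≤ λ + c for all r ∈ R. Consequently, the supremum of val(f) over all almost-equal flows f equals the supremum over λ ∈ [0, u_R] of the maximum value of a flow in the network G_λ in which every edge of R has lower capacity λ and upper capacity min{u(r), λ+c}. -/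
open Finset

/-- The total flow out of a node `v` (with respect to the map `ends`, which is taken
to be the source map for outflow and the target map for inflow). -/
def nodeFlow {V E : Type*} [Fintype E] [DecidableEq V]
    (ends : E → V) (f : E → ℝ) (v : V) : ℝ :=
  ∑ e ∈ univ.filter (fun e => ends e = v), f e

/-- A function with `0 ≤ f ≤ u` on a nonempty finite set exceeds its minimum by at most `c`
iff its values lie in a window `[lam, lam + c]` with `0 ≤ lam ≤ min u`. -/
theorem exists_window_iff {E : Type*} (f u : E → ℝ) {R : Finset E} (hR : R.Nonempty) (c : ℝ)
    (hf : ∀ e ∈ R, 0 ≤ f e ∧ f e ≤ u e) :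
    (∀ r ∈ R, f r ≤ R.inf' hR f + c) ↔
      ∃ lam, 0 ≤ lam ∧ lam ≤ R.inf' hR u ∧ ∀ r ∈ R, lam ≤ f r ∧ f r ≤ lam + c := by
  constructor
  · intro h
    exact ⟨R.inf' hR f, Finset.le_inf' hR f fun r hr => (hf r hr).1,
      Finset.le_inf' hR u fun r hr => (Finset.inf'_le f hr).trans (hf r hr).2,
      fun r hr => ⟨Finset.inf'_le f hr, h r hr⟩⟩
  · rintro ⟨lam, -, -, h⟩ r hr
    have hlam : lam ≤ R.inf' hR f := Finset.le_inf' hR f fun r hr => (h r hr).1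
    linarith [(h r hr).2]

/-- In a finite directed graph with capacities `u`, homologous edge set `R ≠ ∅` and
constant `c ≥ 0`, a capacity-feasible flow `f` satisfies the almost-equal condition
`f r ≤ (min_{r'∈R} f r') + c` on `R` iff there is `λ ∈ [0, u_R]`
(`u_R = min_{r∈R} u r`) with `λ ≤ f r ≤ λ + c` for all `r ∈ R`.  Consequently, the
supremum of `val f` over all almost-equal flows equals the supremum over
`λ ∈ [0, u_R]` of the values of flows in the network `G_λ` in which every `r ∈ R` has
lower capacity `λ` and upper capacity `min (u r) (λ + c)`. -/
theorem aemfp_reduces_to_parametric_flow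
    {V E : Type*} [Fintype V] [Fintype E] [DecidableEq V] [DecidableEq E]
    (src tgt : E → V) (u : E → ℝ) (hu : ∀ e, 0 ≤ u e)
    (s t : V) (hst : s ≠ t)
    (R : Finset E) (hR : R.Nonempty) (c : ℝ) (hc : 0 ≤ c) :
    (∀ f : E → ℝ,
      (∀ e, 0 ≤ f e ∧ f e ≤ u e) →
      (∀ v, v ≠ s → v ≠ t → nodeFlow src f v = nodeFlow tgt f v) →
      ((∀ r ∈ R, f r ≤ R.inf' hR f + c) ↔
        ∃ lam, 0 ≤ lam ∧ lam ≤ R.inf' hR u ∧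
          ∀ r ∈ R, lam ≤ f r ∧ f r ≤ lam + c)) ∧
    sSup {v : ℝ | ∃ f : E → ℝ,
        (∀ e, 0 ≤ f e ∧ f e ≤ u e) ∧
        (∀ w, w ≠ s → w ≠ t → nodeFlow src f w = nodeFlow tgt f w) ∧
        (∀ r ∈ R, f r ≤ R.inf' hR f + c) ∧
        nodeFlow tgt f t - nodeFlow src f t = v}
      = sSup {v : ℝ | ∃ lam, 0 ≤ lam ∧ lam ≤ R.inf' hR u ∧
          ∃ f : E → ℝ,
            (∀ e, 0 ≤ f e ∧ f e ≤ u e) ∧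
            (∀ r ∈ R, lam ≤ f r ∧ f r ≤ min (u r) (lam + c)) ∧
            (∀ w, w ≠ s → w ≠ t → nodeFlow src f w = nodeFlow tgt f w) ∧
            nodeFlow tgt f t - nodeFlow src f t = v} := by
  have key := fun f hf => exists_window_iff f u hR c hf
  refine ⟨fun f hf _ => key f fun e _ => hf e, ?_⟩
  congr 1
  ext v
  constructor
  · rintro ⟨f, hf, hcons, hae, hv⟩
    obtain ⟨lam, h0, hu', hlam⟩ := (key f fun e _ => hf e).1 hae
    exact ⟨lam, h0, hu', f, hf,
      fun r hr => ⟨(hlam r hr).1, le_min (hf r).2 (hlam r hr).2⟩, hcons, hv⟩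
  · rintro ⟨lam, h0, hu', f, hf, hlam, hcons, hv⟩
    exact ⟨f, hf, hcons, (key f fun e _ => hf e).2 ⟨lam, h0, hu',
      fun r hr => ⟨(hlam r hr).1, (hlam r hr).2.trans (min_le_right _ _)⟩⟩, hv⟩
end

section
/- Let F : ℝ → ℝ be the pointwise minimum of a nonempty finite family of affine functions λ ↦ a_i + b_i λ where all a_i are integers and all b_i are integers with |b_i| ≤ m for some m ≥ 1. Then any two distinct breakpoints λ ≠ λ' of F satisfy |λ − λ'| ≥ 1/(4m²). -/
open Filter Topology in
/-- At a breakpoint of a pointwise minimum of finitely many affine functions, two of the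
functions with different slopes agree. -/
theorem exists_slope_ne_of_derivWithin_iInf_affine_ne {ι : Type*} [Finite ι] [Nonempty ι]
    (a b : ι → ℝ) (F : ℝ → ℝ) (hF : ∀ x, F x = ⨅ i, (a i + b i * x)) (x : ℝ)
    (hx : derivWithin F (Set.Iic x) x ≠ derivWithin F (Set.Ici x) x) :
    ∃ i j, b i ≠ b j ∧ a i + b i * x = a j + b j * x := by
  by_contra! h
  apply hx
  obtain ⟨i, hi⟩ := Finite.exists_min fun i ↦ a i + b i * x
  have hev : ∀ᶠ z in 𝓝 x, ∀ j, a i + b i * z ≤ a j + b j * z := by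
    refine eventually_all.2 fun j ↦ ?_
    by_cases hij : b i = b j
    · refine Eventually.of_forall fun z ↦ ?_
      have := hi j
      rw [hij] at this ⊢
      linarith
    · have hlt : a i + b i * x < a j + b j * x := lt_of_le_of_ne (hi j) (h i j hij)
      have hci : ContinuousAt (fun z ↦ a i + b i * z) x := by fun_prop
      have hcj : ContinuousAt (fun z ↦ a j + b j * z) x := by fun_prop
      exact (hci.eventually_lt hcj hlt).mono fun z hz ↦ hz.le
  have heq : F =ᶠ[𝓝 x] fun z ↦ a i + b i * z := hev.mono fun z hz ↦ by
    rw [hF]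
    exact le_antisymm (ciInf_le (Set.finite_range _).bddBelow i) (le_ciInf hz)
  have hd : HasDerivAt F (b i) x := by
    refine HasDerivAt.congr_of_eventuallyEq ?_ heq
    simpa using ((hasDerivAt_id x).const_mul (b i)).const_add (a i)
  rw [hd.hasDerivWithinAt.derivWithin (uniqueDiffOn_Iic x x Set.self_mem_Iic),
    hd.hasDerivWithinAt.derivWithin (uniqueDiffOn_Ici x x Set.self_mem_Ici)]

/-- Distinct rational numbers with denominators of absolute value at most `N` are at distance
at least `1 / N ^ 2`. -/
theorem one_div_sq_le_abs_sub_of_mul_eq_intCast {p q r s : ℤ} {N x y : ℝ}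
    (hq : q ≠ 0) (hs : s ≠ 0) (hqN : |(q : ℝ)| ≤ N) (hsN : |(s : ℝ)| ≤ N)
    (hx : q * x = p) (hy : s * y = r) (hxy : x ≠ y) : 1 / N ^ 2 ≤ |x - y| := by
  have hq' : (0 : ℝ) < |(q : ℝ)| := by positivity
  have hN : 0 < N := hq'.trans_le hqN
  have key : (q : ℝ) * s * (x - y) = ((p * s - r * q : ℤ) : ℝ) := by
    push_cast
    linear_combination (s : ℝ) * hx - (q : ℝ) * hy
  have hne : p * s - r * q ≠ 0 := by
    intro h0
    rw [h0, Int.cast_zero] at key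
    have : (q : ℝ) * s * (x - y) ≠ 0 := by
      have := sub_ne_zero.2 hxy
      positivity
    exact this key
  have hone : (1 : ℝ) ≤ |(q : ℝ)| * |(s : ℝ)| * |x - y| := by
    rw [← abs_mul, ← abs_mul, key]
    exact_mod_cast Int.one_le_abs hne
  rw [div_le_iff₀ (by positivity)]
  calc (1 : ℝ) ≤ |(q : ℝ)| * |(s : ℝ)| * |x - y| := hone
    _ ≤ N * N * |x - y| := by gcongr
    _ = |x - y| * N ^ 2 := by ring


/-- Let `F` be the pointwise minimum of a nonempty finite family of affine functions
`λ ↦ a i + b i * λ` with integer coefficients `a i`, `b i` and `|b i| ≤ m`, `m ≥ 1`.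
Then any two distinct breakpoints of `F` (points where left and right derivatives of
`F` differ) are at distance at least `1/(4m²)`. -/
theorem min_affine_breakpoints_separated
    {ι : Type*} [Fintype ι] [Nonempty ι]
    (a b : ι → ℤ) (m : ℕ) (hm : 1 ≤ m) (hb : ∀ i, |b i| ≤ (m : ℤ))
    (F : ℝ → ℝ) (hF : ∀ x, F x = ⨅ i, ((a i : ℝ) + (b i : ℝ) * x))
    (x y : ℝ)
    (hx : derivWithin F (Set.Iic x) x ≠ derivWithin F (Set.Ici x) x)
    (hy : derivWithin F (Set.Iic y) y ≠ derivWithin F (Set.Ici y) y)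
    (hxy : x ≠ y) :
    1 / (4 * (m : ℝ) ^ 2) ≤ |x - y| := by
  obtain ⟨i, j, hij, hxe⟩ := exists_slope_ne_of_derivWithin_iInf_affine_ne _ _ F hF x hx
  obtain ⟨k, l, hkl, hye⟩ := exists_slope_ne_of_derivWithin_iInf_affine_ne _ _ F hF y hy
  have hbound : ∀ i j, |((b i - b j : ℤ) : ℝ)| ≤ 2 * m := fun i j ↦ by
    have h : |b i - b j| ≤ 2 * (m : ℤ) := by linarith [abs_sub (b i) (b j), hb i, hb j]
    exact_mod_cast h
  have := one_div_sq_le_abs_sub_of_mul_eq_intCast (p := a j - a i) (r := a l - a k)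
    (sub_ne_zero.2 fun h ↦ hij (by rw [h])) (sub_ne_zero.2 fun h ↦ hkl (by rw [h]))
    (hbound i j) (hbound k l) (by push_cast; linarith) (by push_cast; linarith) hxy
  rwa [mul_pow, show (2 : ℝ) ^ 2 = 4 by norm_num] at this
end

section
/- If the X3C instance has a solution, then in the extended network G' whose homologous set R_b carries the deviation function Δ_b(x) = kx (and all other homologous sets the deviation Δ(x) = x + 1), there exists a feasible integer almost-equal s-t''-flow of value at least 7q/3 + k. -/
/-- An integer almost-equal `s`-`t''`-flow in the extended network `G'` obtained from
the network `G` of an X3C instance by adding nodes `t'`, `t''`, one edge `(t,t')` of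
capacity `7q/3`, `7q/3` parallel edges `(t',t'')` of capacity 1, and `k` parallel
bonus edges `(s,t'')` of capacity 2.  Fields: `fs i` is the flow on `(s,S_i)` (cap. 5),
`fb i` on the edge `(S_i,t)` (cap. 2), `fm i j` on `(S_i,a_j)` (cap. 1, present iff
`a_j ∈ S_i`), `fa j` on `(a_j,t)` (cap. 1), `ft` on `(t,t')`, `fp p` on the `p`-th
parallel edge `(t',t'')`, and `fc b` on the `b`-th bonus edge `(s,t'')`.
The homologous sets `R_1,…,R_q,R_0` and the additional set `R_b` (all edges `(t',t'')`
together with all bonus edges `(s,t'')`) carry the deviations `Δ(x) = x + 1` (for `R_0,…,R_q`) and `Δ_b(x) = k·x` (for `R_b`), expressed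
equivalently pairwise within each homologous set. -/
structure ExtIntAEFlowK {q : ℕ} (I : X3C q) (k : ℕ) where
  fs : Fin q → ℤ
  fb : Fin q → ℤ
  fm : Fin q → Fin q → ℤ
  fa : Fin q → ℤ
  ft : ℤ
  fp : Fin (7 * q / 3) → ℤ
  fc : Fin k → ℤ
  fs_nonneg : ∀ i, 0 ≤ fs i
  fs_le : ∀ i, fs i ≤ 5
  fb_nonneg : ∀ i, 0 ≤ fb i
  fb_le : ∀ i, fb i ≤ 2
  fm_nonneg : ∀ i j, 0 ≤ fm i j
  fm_le : ∀ i j, fm i j ≤ 1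
  fm_not_mem : ∀ i j, j ∉ I.sets i → fm i j = 0
  fa_nonneg : ∀ j, 0 ≤ fa j
  fa_le : ∀ j, fa j ≤ 1
  ft_nonneg : 0 ≤ ft
  ft_le : ft ≤ 7 * (q : ℤ) / 3
  fp_nonneg : ∀ p, 0 ≤ fp p
  fp_le : ∀ p, fp p ≤ 1
  fc_nonneg : ∀ b, 0 ≤ fc b
  fc_le : ∀ b, fc b ≤ 2
  consS : ∀ i, fs i = (∑ j ∈ I.sets i, fm i j) + fb i
  consA : ∀ j, (∑ i, fm i j) = fa j
  consT : (∑ i, fb i) + (∑ j, fa j) = ft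
  consT' : ft = ∑ p, fp p
  hom_mm : ∀ i, ∀ j ∈ I.sets i, ∀ j' ∈ I.sets i, fm i j ≤ fm i j' + 1
  hom_mb : ∀ i, ∀ j ∈ I.sets i, fm i j ≤ fb i + 1
  hom_bm : ∀ i, ∀ j ∈ I.sets i, fb i ≤ fm i j + 1
  hom_a : ∀ j j', fa j ≤ fa j' + 1
  hom_pp : ∀ p p', fp p ≤ (k : ℤ) * fp p'
  hom_pc : ∀ p b, fp p ≤ (k : ℤ) * fc b
  hom_cp : ∀ b p, fc b ≤ (k : ℤ) * fp p
  hom_cc : ∀ b b', fc b ≤ (k : ℤ) * fc b'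

/-- The value of the flow: the net flow into the sink `t''`. -/
def ExtIntAEFlowK.val {q : ℕ} {I : X3C q} {k : ℕ} (f : ExtIntAEFlowK I k) : ℤ :=
  (∑ p, f.fp p) + (∑ b, f.fc b)

/-- In an exact cover, every element of the ground set lies in exactly one selected set. -/
theorem X3C.sum_selected_eq_one {q : ℕ} (I : X3C q) (T : Finset (Fin q))
    (hdisj : ∀ i ∈ T, ∀ i' ∈ T, i ≠ i' → Disjoint (I.sets i) (I.sets i'))
    (hcover : T.biUnion I.sets = Finset.univ) (j : Fin q) :
    (∑ i, if i ∈ T ∧ j ∈ I.sets i then (1 : ℤ) else 0) = 1 := by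
  obtain ⟨i, hi, hj⟩ := Finset.mem_biUnion.mp (hcover ▸ Finset.mem_univ j)
  rw [Finset.sum_eq_single i]
  · simp [hi, hj]
  · intro i' _ hne
    refine if_neg fun h => ?_
    exact Finset.disjoint_left.mp (hdisj i' h.1 i hi hne) h.2 hj
  · simp

/-- If the X3C instance has a solution, then in the extended network whose homologous
set `R_b` carries the deviation `Δ_b(x) = k·x` (all other homologous sets carrying
`Δ(x) = x + 1`), there is a feasible integer almost-equal `s`-`t''`-flow of value at
least `7q/3 + k`. -/
theorem ext_flow_value_ge_of_x3c_solution
    (q : ℕ) (hq : 3 ∣ q) (I : X3C q) (k : ℕ) (hk : 1 ≤ k)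
    (hsol : I.HasSolution) :
    ∃ f : ExtIntAEFlowK I k, 7 * (q : ℤ) / 3 + k ≤ f.val := by
  obtain ⟨T, hcard, hdisj, hcover⟩ := hsol
  have hk' : (1 : ℤ) ≤ k := by exact_mod_cast hk
  refine ⟨{
    fs := fun i => if i ∈ T then 5 else 1
    fb := fun i => if i ∈ T then 2 else 1
    fm := fun i j => if i ∈ T ∧ j ∈ I.sets i then 1 else 0
    fa := fun _ => 1
    ft := 7 * (q : ℤ) / 3
    fp := fun _ => 1
    fc := fun _ => 1
    fs_nonneg := fun i => by split_ifs <;> norm_num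
    fs_le := fun i => by split_ifs <;> norm_num
    fb_nonneg := fun i => by split_ifs <;> norm_num
    fb_le := fun i => by split_ifs <;> norm_num
    fm_nonneg := fun i j => by split_ifs <;> norm_num
    fm_le := fun i j => by split_ifs <;> norm_num
    fm_not_mem := fun i j h => by simp [h]
    fa_nonneg := fun _ => zero_le_one
    fa_le := fun _ => le_rfl
    ft_nonneg := by positivity
    ft_le := le_rfl
    fp_nonneg := fun _ => zero_le_one
    fp_le := fun _ => le_rfl
    fc_nonneg := fun _ => zero_le_one
    fc_le := fun _ => one_le_two
    consS := fun i => ?_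
    consA := fun j => I.sum_selected_eq_one T hdisj hcover j
    consT := ?_
    consT' := by simp
    hom_mm := fun i j hj j' hj' => by simp [hj, hj']
    hom_mb := fun i j _ => by split_ifs <;> norm_num
    hom_bm := fun i j hj => by by_cases hi : i ∈ T <;> simp [hi, hj]
    hom_a := fun _ _ => by norm_num
    hom_pp := fun _ _ => by simpa using hk'
    hom_pc := fun _ _ => by simpa using hk'
    hom_cp := fun _ _ => by simpa using hk'
    hom_cc := fun _ _ => by simpa using hk' }, ?_⟩
  · have hsum : (∑ j ∈ I.sets i, if i ∈ T ∧ j ∈ I.sets i then (1 : ℤ) else 0) =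
        ∑ j ∈ I.sets i, if i ∈ T then (1 : ℤ) else 0 :=
      Finset.sum_congr rfl fun j hj => by simp [hj]
    rw [hsum, Finset.sum_const, I.card3 i]
    split_ifs <;> norm_num
  · have hb : (∑ i, if i ∈ T then (2 : ℤ) else 1) = q + T.card := by
      have hsplit : ∀ i, (if i ∈ T then (2 : ℤ) else 1) = 1 + if i ∈ T then 1 else 0 :=
        fun i => by split_ifs <;> norm_num
      simp [hsplit, Finset.sum_add_distrib]
    rw [hb, hcard]
    simp only [Finset.sum_const, Finset.card_univ, Fintype.card_fin, nsmul_eq_mul, mul_one]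
    omega
  · simp [ExtIntAEFlowK.val]
end
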